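/- Let Ω ⊂ ℝⁿ be a bounded open set, u : Ω → ℝ bounded and lower semicontinuous, q > 2 and ε > 0. Suppose that at a point x₀ ∈ Ω_{r(ε)} the infimal convolution u_ε admits a second-order expansion: there exist w ∈ ℝⁿ and a symmetric n×n matrix A with u_ε(y) = u_ε(x₀) + ⟨w, y−x₀⟩ + (1/2)⟨A(y−x₀), y−x₀⟩ + o(|y−x₀|²) as y → x₀. Then ⟨Aξ, ξ⟩ ≤ ((q−1)/ε) |w|^{(q−2)/(q−1)} |ξ|² for every ξ ∈ ℝⁿ. -/

import Mathlib

open MeasureTheory Metric Set Filter Asymptotics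
open scoped RealInnerProductSpace NNReal Topology

noncomputable section

abbrev En (n : ℕ) := EuclideanSpace ℝ (Fin n)

/-- The nondivergence-form `p(·)`-Laplacian `-Δ_{p(·)} φ` at `x`. -/
noncomputable def negPLap {n : ℕ} (p φ : En n → ℝ) (x : En n) : ℝ :=
  -(‖gradient φ x‖ ^ (p x - 2) *
      LinearMap.trace ℝ (En n) (fderiv ℝ (gradient φ) x : En n →ₗ[ℝ] En n))
  - (p x - 2) * ‖gradient φ x‖ ^ (p x - 4) *
      ⟪fderiv ℝ (gradient φ) x (gradient φ x), gradient φ x⟫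
  - ‖gradient φ x‖ ^ (p x - 2) * Real.log ‖gradient φ x‖ *
      ⟪gradient p x, gradient φ x⟫

/-- `u` is a viscosity supersolution of `-Δ_{p(·)} u = 0` on an open set `D`. -/
def IsViscositySupersolution {n : ℕ} (p u : En n → ℝ) (D : Set (En n)) : Prop :=
  ∀ x₀ ∈ D, ∀ φ : En n → ℝ,
    ContDiffAt ℝ 2 φ x₀ → φ x₀ = u x₀ →
    (∀ᶠ x in 𝓝[≠] x₀, φ x < u x) →
    gradient φ x₀ ≠ 0 → 0 ≤ negPLap p φ x₀

/-- The infimal convolution `u_ε` of `u`. -/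
noncomputable def infConv {n : ℕ} (u : En n → ℝ) (Ω : Set (En n)) (q ε : ℝ) (x : En n) : ℝ :=
  sInf ((fun y => u y + ‖x - y‖ ^ q / (q * ε ^ (q - 1))) '' Ω)

/-- `r(ε) = (q ε^{q-1} (M - m))^{1/q}` where `M = sup u`, `m = inf u`. -/
noncomputable def rEps {n : ℕ} (u : En n → ℝ) (Ω : Set (En n)) (q ε : ℝ) : ℝ :=
  (q * ε ^ (q - 1) * (sSup (u '' Ω) - sInf (u '' Ω))) ^ (1 / q)

/-- `Ω_r = {x ∈ Ω : dist(x, ∂Ω) > r}`. -/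
def innerSet {n : ℕ} (Ω : Set (En n)) (r : ℝ) : Set (En n) :=
  {x ∈ Ω | r < Metric.infDist x (frontier Ω)}

/-- The set of minimizers `Y_ε(x)`. -/
def Yset {n : ℕ} (u : En n → ℝ) (Ω : Set (En n)) (q ε : ℝ) (x : En n) : Set (En n) :=
  {y ∈ Ω | infConv u Ω q ε x = u y + ‖x - y‖ ^ q / (q * ε ^ (q - 1))}

/-- `f` is locally Lipschitz on `s`. -/
def LocLipschitzOn {n : ℕ} (f : En n → ℝ) (s : Set (En n)) : Prop :=
  ∀ x ∈ s, ∃ K : ℝ≥0, ∃ t ∈ 𝓝[s] x, LipschitzOnWith K f t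

open Classical in
/-- `|Du(x)|^{p(x)-2} ⟨Du(x), Dψ(x)⟩`, taken to be `0` where `Du(x) = 0`. -/
noncomputable def weakIntegrand {n : ℕ} (p u ψ : En n → ℝ) (x : En n) : ℝ :=
  if gradient u x = 0 then 0
  else ‖gradient u x‖ ^ (p x - 2) * ⟪gradient u x, gradient ψ x⟫


theorem closedBall_subset_of_lt_infDist_frontier {E : Type*} [NormedAddCommGroup E]
    [NormedSpace ℝ E] {s : Set E} (hs : IsOpen s) {x : E} (hx : x ∈ s) {r : ℝ} (hr : 0 ≤ r)
    (h : r < infDist x (frontier s)) : closedBall x r ⊆ s := by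
  refine (convex_closedBall x r).isPreconnected.subset_left_of_subset_union hs
    isClosed_closure.isOpen_compl (disjoint_compl_right_iff_subset.2 subset_closure) ?_
    ⟨x, mem_closedBall_self hr, hx⟩
  intro y hy
  by_contra hcon
  rw [mem_union, not_or, mem_compl_iff, not_not] at hcon
  have hyf : y ∈ frontier s := by
    rw [hs.frontier_eq]
    exact ⟨hcon.2, hcon.1⟩
  have h1 := infDist_le_dist_of_mem (x := x) hyf
  rw [mem_closedBall, dist_comm] at hy
  linarith

theorem infConv_le {n : ℕ} {Ω : Set (En n)} {u : En n → ℝ} (hbddB : BddBelow (u '' Ω))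
    {q ε : ℝ} (hq : 0 ≤ q) (hε : 0 ≤ ε) (x : En n) {y : En n} (hy : y ∈ Ω) :
    infConv u Ω q ε x ≤ u y + ‖x - y‖ ^ q / (q * ε ^ (q - 1)) := by
  refine csInf_le ?_ (mem_image_of_mem _ hy)
  obtain ⟨m, hm⟩ := hbddB
  refine ⟨m, ?_⟩
  rintro _ ⟨z, hz, rfl⟩
  have h1 : m ≤ u z := hm (mem_image_of_mem _ hz)
  have h2 : 0 ≤ ‖x - z‖ ^ q / (q * ε ^ (q - 1)) := by positivity
  simp only
  linarith

theorem Yset_nonempty {n : ℕ} {Ω : Set (En n)} (hΩo : IsOpen Ω) {u : En n → ℝ}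
    (hbddA : BddAbove (u '' Ω)) (hbddB : BddBelow (u '' Ω)) (hlsc : LowerSemicontinuousOn u Ω)
    {q ε : ℝ} (hq : 0 < q) (hε : 0 < ε) {x : En n} (hx : x ∈ innerSet Ω (rEps u Ω q ε)) :
    (Yset u Ω q ε x).Nonempty := by
  obtain ⟨hxΩ, hxr⟩ := hx
  set K : ℝ := q * ε ^ (q - 1) with hK
  have hKpos : 0 < K := by positivity
  have hosc : 0 ≤ sSup (u '' Ω) - sInf (u '' Ω) := by
    have h1 := le_csSup hbddA (mem_image_of_mem u hxΩ)
    have h2 := csInf_le hbddB (mem_image_of_mem u hxΩ)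
    linarith
  have hr : 0 ≤ rEps u Ω q ε := Real.rpow_nonneg (by positivity) _
  have hrq : rEps u Ω q ε ^ q = K * (sSup (u '' Ω) - sInf (u '' Ω)) := by
    rw [rEps, ← Real.rpow_mul (by positivity), one_div, inv_mul_cancel₀ hq.ne', Real.rpow_one]
  have hsub := closedBall_subset_of_lt_infDist_frontier hΩo hxΩ hr hxr
  have hcont : Continuous fun y : En n => ‖x - y‖ ^ q / K :=
    ((continuous_const.sub continuous_id).norm.rpow_const fun _ => Or.inr hq.le).div_const _
  obtain ⟨y, hy, hmin⟩ := LowerSemicontinuousOn.exists_isMinOn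
    (f := fun y => u y + ‖x - y‖ ^ q / K) ⟨x, mem_closedBall_self hr⟩
    (isCompact_closedBall x (rEps u Ω q ε))
    ((hlsc.mono hsub).add (hcont.lowerSemicontinuous.lowerSemicontinuousOn _))
  have hglobal : ∀ z ∈ Ω, u y + ‖x - y‖ ^ q / K ≤ u z + ‖x - z‖ ^ q / K := by
    intro z hz
    by_cases hzb : z ∈ closedBall x (rEps u Ω q ε)
    · exact hmin hzb
    · have h1 : u y + ‖x - y‖ ^ q / K ≤ u x + ‖x - x‖ ^ q / K := hmin (mem_closedBall_self hr)
      rw [sub_self, norm_zero, Real.zero_rpow hq.ne', zero_div, add_zero] at h1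
      rw [mem_closedBall, not_le, dist_comm, dist_eq_norm] at hzb
      have h2 : sSup (u '' Ω) - sInf (u '' Ω) ≤ ‖x - z‖ ^ q / K := by
        rw [le_div_iff₀ hKpos, mul_comm, ← hrq]
        exact Real.rpow_le_rpow hr hzb.le hq.le
      have h3 := le_csSup hbddA (mem_image_of_mem u hxΩ)
      have h4 := csInf_le hbddB (mem_image_of_mem u hz)
      linarith
  refine ⟨y, hsub hy, le_antisymm (infConv_le hbddB hq.le hε.le x (hsub hy)) ?_⟩
  refine le_csInf ⟨_, mem_image_of_mem _ hxΩ⟩ ?_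
  rintro _ ⟨z, hz, rfl⟩
  exact hglobal z hz

/-- If `F` touches from above a function with second-order expansion `(w, A)` at `x₀`, then along
each line `F` minus a quadratic polynomial of smaller curvature has a local minimum. -/
theorem isLocalMin_sub_quadratic_of_touching {E : Type*} [NormedAddCommGroup E]
    [InnerProductSpace ℝ E] {f F : E → ℝ} {x₀ w : E} {A : E →L[ℝ] E}
    (hexp : (fun y => f y - (f x₀ + ⟪w, y - x₀⟫ + (1 / 2) * ⟪A (y - x₀), y - x₀⟫))
      =o[𝓝 x₀] fun y => ‖y - x₀‖ ^ 2)
    (hle : ∀ x, f x ≤ F x) (heq : f x₀ = F x₀) {ξ : E} {c : ℝ} (hc : c < ⟪A ξ, ξ⟫) :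
    IsLocalMin (fun t : ℝ => F (x₀ + t • ξ) - t * ⟪w, ξ⟫ - c / 2 * t ^ 2) 0 := by
  set δ : ℝ := (⟪A ξ, ξ⟫ - c) / (2 * (‖ξ‖ ^ 2 + 1)) with hδ
  have hδpos : 0 < δ := by
    have : 0 < ⟪A ξ, ξ⟫ - c := sub_pos.2 hc
    positivity
  have hδle : δ * ‖ξ‖ ^ 2 ≤ (⟪A ξ, ξ⟫ - c) / 2 := by
    have : δ * (‖ξ‖ ^ 2 + 1) = (⟪A ξ, ξ⟫ - c) / 2 := by
      rw [hδ]
      field_simp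
    linarith
  have htend : Tendsto (fun t : ℝ => x₀ + t • ξ) (𝓝 0) (𝓝 x₀) := by
    have : Continuous fun t : ℝ => x₀ + t • ξ := by fun_prop
    simpa using this.tendsto 0
  filter_upwards [htend.eventually (hexp.def hδpos)] with t ht
  simp only [add_sub_cancel_left, map_smul, inner_smul_left, inner_smul_right, norm_smul,
    Real.norm_eq_abs, RCLike.conj_to_real, abs_pow, abs_mul, abs_norm, mul_pow,
    sq_abs] at ht
  have h1 := (abs_le.1 ht).1
  have h2 := hle (x₀ + t • ξ)
  have h3 := mul_le_mul_of_nonneg_left hδle (sq_nonneg t)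
  simp only [zero_smul, add_zero, zero_mul, sub_zero, ← heq]
  nlinarith

/-- Necessary second-order condition at a local minimum. -/
theorem deriv_deriv_nonneg_of_isLocalMin {g g' : ℝ → ℝ} {a g'' : ℝ} (hmin : IsLocalMin g a)
    (hg : ∀ᶠ t in 𝓝 a, HasDerivAt g (g' t) t) (hg' : HasDerivAt g' g'' a) : 0 ≤ g'' := by
  by_contra! hneg
  have hd : deriv g =ᶠ[𝓝 a] g' := hg.mono fun t ht => ht.deriv
  have hdd : deriv (deriv g) a = g'' := hd.deriv_eq.trans hg'.deriv
  have hmax : IsLocalMax g a := isLocalMax_of_deriv_deriv_neg (hdd ▸ hneg) hmin.deriv_eq_zero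
    hg.self_of_nhds.continuousAt
  have hconst : g =ᶠ[𝓝 a] fun _ => g a := by
    filter_upwards [hmin, hmax] with t h1 h2 using le_antisymm h2 h1
  have hzero : deriv (deriv g) a = 0 := by
    rw [hconst.deriv.deriv_eq]
    simp
  linarith

theorem norm_add_smul_rpow {E : Type*} [NormedAddCommGroup E] [InnerProductSpace ℝ E]
    (z ξ : E) (q t : ℝ) :
    ‖z + t • ξ‖ ^ q = (‖z‖ ^ 2 + 2 * ⟪z, ξ⟫ * t + ‖ξ‖ ^ 2 * t ^ 2) ^ (q / 2) := by
  have h : ‖z‖ ^ 2 + 2 * ⟪z, ξ⟫ * t + ‖ξ‖ ^ 2 * t ^ 2 = ‖z + t • ξ‖ ^ 2 := by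
    rw [norm_add_sq_real, inner_smul_right, norm_smul, mul_pow, Real.norm_eq_abs, sq_abs]
    ring
  rw [h, ← Real.rpow_natCast, ← Real.rpow_mul (norm_nonneg _)]
  congr 1
  push_cast
  ring

theorem hasDerivAt_quadratic (a b c t : ℝ) :
    HasDerivAt (fun t : ℝ => a + 2 * b * t + c * t ^ 2) (2 * b + 2 * c * t) t := by
  have h := (((hasDerivAt_id t).const_mul (2 * b)).const_add a).add
    (((hasDerivAt_id t).pow 2).const_mul c)
  refine h.congr_deriv ?_
  simp
  ring

theorem eventually_hasDerivAt_quadratic_rpow {a : ℝ} (ha : 0 < a) (b c p : ℝ) :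
    ∀ᶠ t in 𝓝 (0 : ℝ), HasDerivAt (fun t : ℝ => (a + 2 * b * t + c * t ^ 2) ^ p)
      ((2 * b + 2 * c * t) * p * (a + 2 * b * t + c * t ^ 2) ^ (p - 1)) t := by
  have hcont : Continuous fun t : ℝ => a + 2 * b * t + c * t ^ 2 := by fun_prop
  have hpos : ∀ᶠ t in 𝓝 (0 : ℝ), 0 < a + 2 * b * t + c * t ^ 2 :=
    hcont.continuousAt.eventually (lt_mem_nhds (by simpa using ha))
  filter_upwards [hpos] with t ht
  exact (hasDerivAt_quadratic a b c t).rpow_const (Or.inl ht.ne')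

theorem hasDerivAt_deriv_quadratic_rpow {a : ℝ} (ha : 0 < a) (b c p : ℝ) :
    HasDerivAt (fun t : ℝ => (2 * b + 2 * c * t) * p * (a + 2 * b * t + c * t ^ 2) ^ (p - 1))
      (2 * c * p * a ^ (p - 1) + 4 * b ^ 2 * p * (p - 1) * a ^ (p - 2)) 0 := by
  have h1 : HasDerivAt (fun t : ℝ => (2 * b + 2 * c * t) * p) (2 * c * p) 0 := by
    have := (((hasDerivAt_id (0 : ℝ)).const_mul (2 * c)).const_add (2 * b)).mul_const p
    simpa using this
  have h2 := (hasDerivAt_quadratic a b c 0).rpow_const (p := p - 1) (Or.inl (by simpa using ha.ne'))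
  refine (h1.mul h2).congr_deriv ?_
  have : p - 1 - 1 = p - 2 := by ring
  simp [this]
  ring

/-- First- and second-order conditions along a line for the power `‖·‖ ^ q / K` away from `0`. -/
theorem conditions_of_isLocalMin_norm_rpow {E : Type*} [NormedAddCommGroup E]
    [InnerProductSpace ℝ E] {z ξ : E} (hz : z ≠ 0) {q K k d c : ℝ} (hq : 2 ≤ q) (hK : 0 < K)
    (hmin : IsLocalMin (fun t : ℝ => k + ‖z + t • ξ‖ ^ q / K - t * d - c / 2 * t ^ 2) 0) :
    d = q / K * ‖z‖ ^ (q - 2) * ⟪z, ξ⟫ ∧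
      c ≤ q * (q - 1) / K * ‖z‖ ^ (q - 2) * ‖ξ‖ ^ 2 := by
  have hzn : 0 < ‖z‖ := norm_pos_iff.2 hz
  have ha : 0 < ‖z‖ ^ 2 := by positivity
  have hpow : (‖z‖ ^ 2) ^ (q / 2 - 1) = ‖z‖ ^ (q - 2) := by
    rw [← Real.rpow_natCast, ← Real.rpow_mul hzn.le]
    congr 1
    push_cast
    ring
  have hpow' : ‖z‖ ^ 2 * (‖z‖ ^ 2) ^ (q / 2 - 2) = ‖z‖ ^ (q - 2) := by
    rw [← hpow, show q / 2 - 1 = q / 2 - 2 + 1 by ring, Real.rpow_add_one ha.ne', mul_comm]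
  simp only [norm_add_smul_rpow] at hmin
  have hd1 : ∀ᶠ t in 𝓝 (0 : ℝ), HasDerivAt
      (fun t : ℝ => k + (‖z‖ ^ 2 + 2 * ⟪z, ξ⟫ * t + ‖ξ‖ ^ 2 * t ^ 2) ^ (q / 2) / K - t * d
        - c / 2 * t ^ 2)
      ((2 * ⟪z, ξ⟫ + 2 * ‖ξ‖ ^ 2 * t) * (q / 2) *
        (‖z‖ ^ 2 + 2 * ⟪z, ξ⟫ * t + ‖ξ‖ ^ 2 * t ^ 2) ^ (q / 2 - 1) / K - d - c * t) t := by
    filter_upwards [eventually_hasDerivAt_quadratic_rpow ha ⟪z, ξ⟫ (‖ξ‖ ^ 2) (q / 2)] with t ht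
    refine ((((ht.div_const K).const_add k).sub ((hasDerivAt_id t).mul_const d)).sub
      (((hasDerivAt_id t).pow 2).const_mul (c / 2))).congr_deriv ?_
    simp
    ring
  have hd2 := (((hasDerivAt_deriv_quadratic_rpow ha ⟪z, ξ⟫ (‖ξ‖ ^ 2) (q / 2)).div_const K).sub_const
    d).sub ((hasDerivAt_id (0 : ℝ)).const_mul c)
  have hfirst := hmin.hasDerivAt_eq_zero hd1.self_of_nhds
  have hsecond := deriv_deriv_nonneg_of_isLocalMin hmin hd1 hd2
  simp only [mul_zero, add_zero, ne_eq, OfNat.ofNat_ne_zero, not_false_eq_true, zero_pow,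
    sub_zero, mul_one, hpow] at hfirst hsecond
  refine ⟨?_, ?_⟩
  · have : d = 2 * ⟪z, ξ⟫ * (q / 2) * ‖z‖ ^ (q - 2) / K := by linarith
    rw [this]
    ring
  · have hcs : ⟪z, ξ⟫ ^ 2 ≤ ‖z‖ ^ 2 * ‖ξ‖ ^ 2 := by
      rw [← mul_pow, ← sq_abs]
      exact pow_le_pow_left₀ (abs_nonneg _) (abs_real_inner_le_norm z ξ) 2
    have hcoef : 0 ≤ 4 * (q / 2) * (q / 2 - 1) * (‖z‖ ^ 2) ^ (q / 2 - 2) := by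
      have h1 : 0 ≤ q / 2 - 1 := by linarith
      have h2 : 0 ≤ (‖z‖ ^ 2) ^ (q / 2 - 2) := by positivity
      have h3 : 0 ≤ 4 * (q / 2) := by linarith
      positivity
    have hle := mul_le_mul_of_nonneg_left hcs hcoef
    have hnum : 2 * ‖ξ‖ ^ 2 * (q / 2) * ‖z‖ ^ (q - 2) +
        4 * ⟪z, ξ⟫ ^ 2 * (q / 2) * (q / 2 - 1) * (‖z‖ ^ 2) ^ (q / 2 - 2) ≤
        q * (q - 1) * ‖z‖ ^ (q - 2) * ‖ξ‖ ^ 2 := by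
      have : 4 * (q / 2) * (q / 2 - 1) * (‖z‖ ^ 2) ^ (q / 2 - 2) * (‖z‖ ^ 2 * ‖ξ‖ ^ 2) =
          4 * (q / 2) * (q / 2 - 1) * ‖z‖ ^ (q - 2) * ‖ξ‖ ^ 2 := by
        rw [← hpow']
        ring
      rw [this] at hle
      linarith
    have hdiv := div_le_div_of_nonneg_right hnum hK.le
    have : q * (q - 1) / K * ‖z‖ ^ (q - 2) * ‖ξ‖ ^ 2 =
        q * (q - 1) * ‖z‖ ^ (q - 2) * ‖ξ‖ ^ 2 / K := by ring
    linarith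

/-- At the origin `‖·‖ ^ q / K` with `q > 2` has no positive curvature. -/
theorem nonpos_of_isLocalMin_norm_rpow {E : Type*} [NormedAddCommGroup E]
    [NormedSpace ℝ E] {ξ : E} {q K k d c : ℝ} (hq : 2 < q)
    (hmin : IsLocalMin (fun t : ℝ => k + ‖t • ξ‖ ^ q / K - t * d - c / 2 * t ^ 2) 0) :
    c ≤ 0 := by
  have hneg : Tendsto (fun t : ℝ => -t) (𝓝 0) (𝓝 0) := by
    simpa using (continuous_neg (G := ℝ)).tendsto 0
  have hlim : Tendsto (fun t : ℝ => 2 * (‖ξ‖ ^ q / K) * t ^ (q - 2)) (𝓝[>] 0) (𝓝 0) := by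
    have hcont : Continuous fun t : ℝ => 2 * (‖ξ‖ ^ q / K) * t ^ (q - 2) :=
      continuous_const.mul (Real.continuous_rpow_const (by linarith))
    have := hcont.tendsto 0
    rw [Real.zero_rpow (by linarith), mul_zero] at this
    exact this.mono_left nhdsWithin_le_nhds
  refine ge_of_tendsto hlim ?_
  filter_upwards [nhdsWithin_le_nhds hmin, nhdsWithin_le_nhds (hneg.eventually hmin),
    self_mem_nhdsWithin] with t h1 h2 ht
  have ht : 0 < t := ht
  simp only [zero_smul, norm_zero, Real.zero_rpow (by linarith : q ≠ 0), zero_div, add_zero,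
    zero_mul, sub_zero, norm_smul, norm_neg, Real.norm_of_nonneg ht.le, ne_eq,
    OfNat.ofNat_ne_zero, not_false_eq_true, zero_pow, mul_zero, neg_sq,
    Real.mul_rpow ht.le (norm_nonneg ξ)] at h1 h2
  have hsplit : t ^ q = t ^ (q - 2) * t ^ 2 := by
    rw [← Real.rpow_natCast, ← Real.rpow_add ht]
    congr 1
    push_cast
    ring
  rw [hsplit] at h1 h2
  have hsum : c * t ^ 2 ≤ 2 * (‖ξ‖ ^ q / K) * t ^ (q - 2) * t ^ 2 := by
    have : t ^ (q - 2) * t ^ 2 * ‖ξ‖ ^ q / K = ‖ξ‖ ^ q / K * t ^ (q - 2) * t ^ 2 := by ring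
    rw [this] at h1 h2
    linarith
  exact le_of_mul_le_mul_right hsum (by positivity)


/-- second-order Hessian bound for the infimal convolution. -/
theorem stmt15
    {n : ℕ} (hn : 1 ≤ n)
    (Ω : Set (En n)) (hΩo : IsOpen Ω) (hΩb : Bornology.IsBounded Ω)
    (u : En n → ℝ)
    (hbddA : BddAbove (u '' Ω)) (hbddB : BddBelow (u '' Ω))
    (hlsc : LowerSemicontinuousOn u Ω)
    (q ε : ℝ) (hq : 2 < q) (hε : 0 < ε)
    (x₀ : En n) (hx₀ : x₀ ∈ innerSet Ω (rEps u Ω q ε))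
    (w : En n) (A : En n →L[ℝ] En n) (hA : IsSelfAdjoint A)
    (hexp : (fun y => infConv u Ω q ε y -
        (infConv u Ω q ε x₀ + ⟪w, y - x₀⟫ + (1 / 2) * ⟪A (y - x₀), y - x₀⟫))
      =o[𝓝 x₀] fun y => ‖y - x₀‖ ^ 2) :
    ∀ ξ : En n, ⟪A ξ, ξ⟫ ≤ ((q - 1) / ε) * ‖w‖ ^ ((q - 2) / (q - 1)) * ‖ξ‖ ^ 2 := by
  intro ξ
  have hq0 : 0 < q := by linarith
  obtain ⟨y, hyΩ, hy⟩ := Yset_nonempty hΩo hbddA hbddB hlsc hq0 hε hx₀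
  set K : ℝ := q * ε ^ (q - 1) with hKdef
  have hK : 0 < K := by positivity
  have hline : ∀ (η : En n) (c : ℝ), c < ⟪A η, η⟫ → IsLocalMin
      (fun t : ℝ => u y + ‖(x₀ - y) + t • η‖ ^ q / K - t * ⟪w, η⟫ - c / 2 * t ^ 2) 0 := by
    intro η c hc
    have h := isLocalMin_sub_quadratic_of_touching
      (F := fun x => u y + ‖x - y‖ ^ q / K) hexp
      (fun x => infConv_le hbddB hq0.le hε.le x hyΩ) hy hc
    simpa only [add_sub_right_comm] using h
  refine le_of_forall_lt fun c hc => ?_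
  obtain ⟨c', hcc', hc'⟩ := exists_between hc
  refine hcc'.trans_le ?_
  rcases eq_or_ne (x₀ - y) 0 with hz | hz
  · have h := hline ξ c' hc'
    simp only [hz, zero_add] at h
    refine (nonpos_of_isLocalMin_norm_rpow hq h).trans ?_
    have : 0 ≤ q - 1 := by linarith
    positivity
  · have hzn : 0 < ‖x₀ - y‖ := norm_pos_iff.2 hz
    have hw : w = (q / K * ‖x₀ - y‖ ^ (q - 2)) • (x₀ - y) := by
      refine ext_inner_right ℝ fun η => ?_
      rw [real_inner_smul_left]
      exact (conditions_of_isLocalMin_norm_rpow hz hq.le hK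
        (hline η (⟪A η, η⟫ - 1) (by linarith))).1
    have hεq : ε ^ (q - 1) = ε ^ (q - 2) * ε := by
      rw [← Real.rpow_add_one hε.ne']
      congr 1
      ring
    have hwn : ‖w‖ = (‖x₀ - y‖ / ε) ^ (q - 1) := by
      rw [hw, norm_smul, Real.norm_of_nonneg (by positivity), Real.div_rpow hzn.le hε.le,
        show q - 1 = q - 2 + 1 by ring, Real.rpow_add_one hzn.ne', hKdef,
        show q - 1 = q - 2 + 1 by ring]
      field_simp
    have hwp : ‖w‖ ^ ((q - 2) / (q - 1)) = ‖x₀ - y‖ ^ (q - 2) / ε ^ (q - 2) := by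
      have : q - 1 ≠ 0 := by linarith
      rw [hwn, ← Real.rpow_mul (by positivity), mul_div_cancel₀ _ this,
        Real.div_rpow hzn.le hε.le]
    refine (conditions_of_isLocalMin_norm_rpow hz hq.le hK (hline ξ c' hc')).2.trans_eq ?_
    rw [hwp, hKdef, hεq]
    field_simp
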